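/- arXiv:2603.28303 — 2 statements merged into one kernel-verified Lean document; each statement's English description precedes it below -/
import Mathlib

section
/- Let $G$ be a finite group acting on a finite set $X$, let $S \subseteq X$, let $N = \{g \in G : g \cdot S = S\}$ be the setwise stabilizer of $S$, and let $x \in X$. Then $[G : N] \cdot |(G \cdot x) \cap S| = |G \cdot x| \cdot f_S(x)$, where $G \cdot x$ denotes the $G$-orbit of $x$. -/
open Pointwise

/-- The elements of the orbit of `x` lying in a translate of `S` are as many as those lying
in `S`. -/
theorem MulAction.ncard_orbit_inter_smul {G X : Type*} [Group G] [MulAction G X]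
    (S : Set X) (x : X) (g : G) :
    (MulAction.orbit G x ∩ g • S).ncard = (MulAction.orbit G x ∩ S).ncard := by
  rw [← Set.ncard_smul_set g (MulAction.orbit G x ∩ S), Set.smul_set_inter,
    MulAction.smul_orbit]

/-- The number of translates of `S` containing a point is constant on orbits. -/
theorem MulAction.ncard_translates_smul {G X : Type*} [Group G] [MulAction G X]
    (S : Set X) (x : X) (g : G) :
    {T ∈ MulAction.orbit G S | g • x ∈ T}.ncard = {T ∈ MulAction.orbit G S | x ∈ T}.ncard := by
  rw [← Set.ncard_smul_set g {T ∈ MulAction.orbit G S | x ∈ T}]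
  congr 1
  ext T
  rw [Set.mem_smul_set_iff_inv_smul_mem, Set.mem_ofPred_eq, Set.mem_ofPred_eq,
    Set.mem_inv_smul_set_iff, ← MulAction.orbit_eq_iff, ← MulAction.orbit_eq_iff,
    MulAction.orbit_smul]

/-- Let a finite group `G` act on a finite set `X`, `S ⊆ X`, `N` the setwise stabilizer of `S`,
and `x ∈ X`. Then `[G : N] ⬝ |(G⬝x) ∩ S| = |G⬝x| ⬝ f_S(x)`, where `f_S(x)` is the number of
`G`-translates of `S` containing `x`. -/
theorem stmt_5 {G X : Type*} [Group G] [Fintype G] [Fintype X] [MulAction G X]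
    (S : Set X) (x : X) :
    (MulAction.stabilizer G S).index * Nat.card ↥(MulAction.orbit G x ∩ S)
      = Nat.card ↥(MulAction.orbit G x)
        * Nat.card {T : Set X // (∃ g : G, T = g • S) ∧ x ∈ T} := by
  classical
  have h := Finset.card_mul_eq_card_mul (fun (T : Set X) (y : X) => y ∈ T)
    (s := (MulAction.orbit G S).toFinset) (t := (MulAction.orbit G x).toFinset)
    (m := (MulAction.orbit G x ∩ S).ncard)
    (n := {T ∈ MulAction.orbit G S | x ∈ T}.ncard) ?_ ?_
  · rw [← Set.ncard_eq_toFinset_card', ← Set.ncard_eq_toFinset_card',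
      ← MulAction.index_stabilizer] at h
    have e : {T : Set X | (∃ g : G, T = g • S) ∧ x ∈ T} =
        {T ∈ MulAction.orbit G S | x ∈ T} := by
      ext T
      simp [MulAction.mem_orbit_iff, eq_comm]
    rw [← e] at h
    exact h
  · intro T hT
    obtain ⟨g, rfl⟩ := Set.mem_toFinset.mp hT
    rw [← MulAction.ncard_orbit_inter_smul S x g, ← Set.ncard_coe_finset]
    congr 1
    ext y
    simp
  · intro y hy
    obtain ⟨g, rfl⟩ := Set.mem_toFinset.mp hy
    rw [← MulAction.ncard_translates_smul S x g, ← Set.ncard_coe_finset]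
    congr 1
    ext T
    simp
end

section
/- Let $G$ be a finite group acting on a finite set $X$, let $S \subseteq X$, and let $N = \{g \in G : g \cdot S = S\}$ be the setwise stabilizer of $S$. Then $\sum_{x \in S} |\mathrm{Stab}_G(x)| = |N| \cdot \sum_{O} f_S(x_O)$, where the sum on the right runs over the $G$-orbits $O$ on $X$ satisfying $O \cap S \neq \emptyset$, $x_O \in O$ is an arbitrary element of $O$ (the value $f_S(x_O)$ is independent of this choice since $f_S$ is constant on $G$-orbits), and $\mathrm{Stab}_G(x) = \{g \in G : g \cdot x = x\}$. -/
open Pointwise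

/-- The elements of `G` carrying `a` to a point of its orbit form a left coset of the
stabilizer of `a`. -/
theorem Nat.card_smul_eq_of_source {G Y : Type*} [Group G] [MulAction G Y] (a : Y) (h : G) :
    Nat.card {g : G // g • a = h • a} = Nat.card (MulAction.stabilizer G a) :=
  Nat.card_congr <| (Equiv.mulLeft h⁻¹).subtypeEquiv fun g => by
    simp [MulAction.mem_stabilizer_iff, mul_smul, inv_smul_eq_iff]

/-- The elements of `G` carrying `a` to a point `b` of its orbit form a right coset of the
stabilizer of `b`. -/
theorem Nat.card_smul_eq_of_target {G Y : Type*} [Group G] [MulAction G Y] {a b : Y}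
    (hb : b ∈ MulAction.orbit G a) :
    Nat.card {g : G // g • a = b} = Nat.card (MulAction.stabilizer G b) := by
  obtain ⟨h, rfl⟩ := hb
  exact Nat.card_congr <| (Equiv.mulRight h⁻¹).subtypeEquiv fun g => by
    simp [MulAction.mem_stabilizer_iff, mul_smul]

open Classical in
/-- Counting the group elements that carry `a` into `P` by the image of `a`. -/
theorem Nat.card_smul_mem_eq_sum {G Y : Type*} [Group G] [Finite G] [Fintype Y] [MulAction G Y]
    (a : Y) (P : Set Y) :
    Nat.card {g : G // g • a ∈ P} =
      ∑ y : Y with y ∈ P ∧ y ∈ MulAction.orbit G a, Nat.card {g : G // g • a = y} := by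
  have := Fintype.ofFinite G
  simp only [Nat.card_eq_fintype_card, Fintype.card_subtype]
  rw [Finset.card_eq_sum_card_fiberwise (f := fun g : G => g • a)
    (t := {y : Y | y ∈ P ∧ y ∈ MulAction.orbit G a})]
  · refine Finset.sum_congr rfl fun y hy => ?_
    congr 1
    ext g
    simp only [Finset.mem_filter, Finset.mem_univ, true_and] at hy ⊢
    exact ⟨fun h => h.2, fun h => ⟨h ▸ hy.1, h⟩⟩
  · intro g hg
    simpa using hg

/-- The number of `g` with `x ∈ g • S` is the order of the setwise stabilizer of `S` times the
number of translates of `S` containing `x`. -/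
theorem Nat.card_mem_smul_set {G X : Type*} [Group G] [Finite G] [Finite X] [MulAction G X]
    (S : Set X) (x : X) :
    Nat.card {g : G // x ∈ g • S} = Nat.card (MulAction.stabilizer G S) *
      Nat.card {T : Set X // (∃ g : G, T = g • S) ∧ x ∈ T} := by
  classical
  have := Fintype.ofFinite X
  have key := Nat.card_smul_mem_eq_sum (G := G) S {T : Set X | x ∈ T}
  simp only [Set.mem_ofPred_eq] at key
  rw [key, Finset.sum_congr rfl (g := fun _ => Nat.card (MulAction.stabilizer G S)),
    Finset.sum_const, smul_eq_mul, mul_comm, Nat.card_eq_fintype_card (α := {T : Set X // (∃ g : G, T = g • S) ∧ x ∈ T}),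
    Fintype.card_subtype]
  · congr 2
    ext T
    simp [MulAction.mem_orbit_iff, and_comm, eq_comm]
  · intro T hT
    obtain ⟨-, h, rfl⟩ := (Finset.mem_filter.1 hT).2
    exact Nat.card_smul_eq_of_source S h

/-- Let a finite group `G` act on a finite set `X`, `S ⊆ X`, `N` the setwise stabilizer of `S`,
and let `R` be a set of representatives of the `G`-orbits on `X` meeting `S`. Then
`∑_{x ∈ S} |Stab_G(x)| = |N| ⬝ ∑_{x ∈ R} f_S(x)`. -/
theorem stmt_6 {G X : Type*} [Group G] [Fintype G] [Fintype X] [MulAction G X]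
    (S : Set X) (R : Finset X)
    (hmeet : ∀ x ∈ R, (MulAction.orbit G x ∩ S).Nonempty)
    (hrep : ∀ y : X, (MulAction.orbit G y ∩ S).Nonempty →
      ∃! x, x ∈ R ∧ y ∈ MulAction.orbit G x) :
    (∑ᶠ x ∈ S, Nat.card (MulAction.stabilizer G x))
      = Nat.card (MulAction.stabilizer G S)
        * ∑ x ∈ R, Nat.card {T : Set X // (∃ g : G, T = g • S) ∧ x ∈ T} := by
  classical
  have count (x : X) : Nat.card (MulAction.stabilizer G S) *
      Nat.card {T : Set X // (∃ g : G, T = g • S) ∧ x ∈ T} =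
      ∑ y : X with y ∈ S ∧ y ∈ MulAction.orbit G x, Nat.card (MulAction.stabilizer G y) := by
    rw [← Nat.card_mem_smul_set, Nat.card_congr ((Equiv.inv G).subtypeEquiv
      (q := fun g => g • x ∈ S) fun g => Set.mem_smul_set_iff_inv_smul_mem),
      Nat.card_smul_mem_eq_sum]
    exact Finset.sum_congr rfl fun y hy =>
      Nat.card_smul_eq_of_target (Finset.mem_filter.1 hy).2.2
  rw [Finset.mul_sum, Finset.sum_congr rfl fun x _ => count x, ← Finset.sum_biUnion]
  · refine finsum_mem_eq_sum_of_inter_support_eq _ ?_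
    congr 1
    ext y
    simp only [Finset.coe_biUnion, Finset.coe_filter, Finset.mem_univ, true_and,
      Set.mem_iUnion, Set.mem_ofPred_eq, Finset.mem_coe, exists_prop]
    refine ⟨fun hy => ?_, fun ⟨_, _, hy, _⟩ => hy⟩
    obtain ⟨x, ⟨hx, hyx⟩, -⟩ := hrep y ⟨y, MulAction.mem_orbit_self y, hy⟩
    exact ⟨x, hx, hy, hyx⟩
  · intro x hx x' hx' hne
    refine Finset.disjoint_left.2 fun y hy hy' => hne ?_
    simp only [Finset.mem_filter, Finset.mem_univ, true_and] at hy hy'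
    exact (hrep y ⟨y, MulAction.mem_orbit_self y, hy.1⟩).unique ⟨hx, hy.2⟩ ⟨hx', hy'.2⟩
end
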